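/- arXiv:1604.03156 — 6 statements merged into one kernel-verified Lean document; each statement's English description precedes it below -/
import Mathlib

section
/- Let q(z)=q₀z²+2q₁z+q₂ and q̃(z)=q̃₀z²+2q̃₁z+q̃₂ be real quadratic polynomials with polarizations q(x,y) and q̃(x,y). Let I, J ⊆ ℝ be nonempty open intervals and let x̃ : I → ℝ and ỹ : J → ℝ be functions such that for all (x,y) ∈ I×J one has q(x,y) ≠ 0, x̃(x) ≠ ỹ(y), and q(x,y)·(x̃(x) − ỹ(y)) = q̃(x̃(x), ỹ(y))·(x − y). Then x̃ and ỹ are rational-linear: there exist a,b,c,d ∈ ℝ with ad − bc ≠ 0 such that cx + d ≠ 0 and x̃(x) = (ax+b)/(cx+d) for all x ∈ I, and there exist a',b',c',d' ∈ ℝ with a'd' − b'c' ≠ 0 such that c'y + d' ≠ 0 and ỹ(y) = (a'y+b')/(c'y+d') for all y ∈ J. -/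
/-- A nonempty open set of reals contains a three-term arithmetic progression. -/
lemma IsOpen.exists_pos_add_sub_mem {S : Set ℝ} (hSo : IsOpen S) (hSne : S.Nonempty) :
    ∃ s ε : ℝ, 0 < ε ∧ s ∈ S ∧ s + ε ∈ S ∧ s - ε ∈ S := by
  obtain ⟨s, hs⟩ := hSne
  obtain ⟨δ, hδ, hball⟩ := Metric.isOpen_iff.mp hSo s hs
  refine ⟨s, δ / 2, by positivity, hs, hball ?_, hball ?_⟩ <;>
    simp [Metric.mem_ball, abs_of_pos, hδ]

/-- A nonzero quadratic polynomial does not vanish identically on a nonempty open set. -/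
lemma exists_mem_quadratic_ne_zero {S : Set ℝ} (hSo : IsOpen S) (hSne : S.Nonempty)
    {q0 q1 q2 : ℝ} (hq : ¬(q0 = 0 ∧ q1 = 0 ∧ q2 = 0)) :
    ∃ s ∈ S, q0 * s * s + q1 * (s + s) + q2 ≠ 0 := by
  obtain ⟨s, ε, hε, hs, hs_add, hs_sub⟩ := hSo.exists_pos_add_sub_mem hSne
  by_contra! h
  have e0 := h s hs
  have e1 := h _ hs_add
  have e2 := h _ hs_sub
  have h0 : q0 = 0 := by
    have : q0 * ε ^ 2 = 0 := by linear_combination (e1 + e2) / 2 - e0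
    simpa [hε.ne'] using this
  subst h0
  have h1 : q1 = 0 := by
    have : q1 * ε = 0 := by linear_combination (e1 - e0) / 2
    simpa [hε.ne'] using this
  subst h1
  exact hq ⟨rfl, rfl, by linear_combination e0⟩

/-- If the conformal factor identity holds on `I × J` then the coordinate change on `I` is
rational-linear. -/
lemma exists_rational_linear_of_conformal_factor_eq {q0 q1 q2 qt0 qt1 qt2 : ℝ} {I J : Set ℝ}
    (hIo : IsOpen I) (hIne : I.Nonempty) (hJo : IsOpen J) (hJne : J.Nonempty) {xt yt : ℝ → ℝ}
    (hq : ∀ x ∈ I, ∀ y ∈ J, q0 * x * y + q1 * (x + y) + q2 ≠ 0)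
    (hne : ∀ x ∈ I, ∀ y ∈ J, xt x ≠ yt y)
    (heq : ∀ x ∈ I, ∀ y ∈ J,
      (q0 * x * y + q1 * (x + y) + q2) * (xt x - yt y)
        = (qt0 * xt x * yt y + qt1 * (xt x + yt y) + qt2) * (x - y)) :
    ∃ a b c d : ℝ, a * d - b * c ≠ 0 ∧
      ∀ x ∈ I, c * x + d ≠ 0 ∧ xt x = (a * x + b) / (c * x + d) := by
  obtain ⟨s, ε, hε, hs, hs_add, -⟩ := hIo.exists_pos_add_sub_mem hIne
  obtain ⟨y, hy, hqy⟩ : ∃ y ∈ J, q0 * y * y + q1 * (y + y) + q2 ≠ 0 := by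
    refine exists_mem_quadratic_ne_zero hJo hJne ?_
    rintro ⟨rfl, rfl, rfl⟩
    obtain ⟨y, hy⟩ := hJne
    exact hq s hs y hy (by ring)
  set Y := yt y
  have hqtY : qt0 * Y * Y + qt1 * (Y + Y) + qt2 ≠ 0 := by
    intro hroot
    -- At a root `Y` of `q̃` the identity reduces to a linear one in `x` that vanishes at `x = y`.
    have key : ∀ x ∈ I, q0 * x * y + q1 * (x + y) + q2 = (qt0 * Y + qt1) * (x - y) := by
      intro x hx
      refine mul_right_cancel₀ (sub_ne_zero.mpr (hne x hx y hy)) ?_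
      linear_combination heq x hx y hy + (x - y) * hroot
    have k0 := key s hs
    have k1 := key _ hs_add
    have hslope : q0 * y + q1 = qt0 * Y + qt1 := by
      refine mul_right_cancel₀ hε.ne' ?_
      linear_combination k1 - k0
    exact hqy (by linear_combination k0 - (s - y) * hslope)
  have hdet := mul_ne_zero hqy hqtY
  refine ⟨(q0 * y + q1) * Y + (qt1 * Y + qt2), (q1 * y + q2) * Y - (qt1 * Y + qt2) * y,
    q0 * y + q1 - (qt0 * Y + qt1), q1 * y + q2 + (qt0 * Y + qt1) * y, ?_, fun x hx ↦ ?_⟩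
  · convert hdet using 1
    ring
  · have hlin : xt x * ((q0 * y + q1 - (qt0 * Y + qt1)) * x + (q1 * y + q2 + (qt0 * Y + qt1) * y))
        = ((q0 * y + q1) * Y + (qt1 * Y + qt2)) * x
          + ((q1 * y + q2) * Y - (qt1 * Y + qt2) * y) := by
      linear_combination heq x hx y hy
    have hden : (q0 * y + q1 - (qt0 * Y + qt1)) * x + (q1 * y + q2 + (qt0 * Y + qt1) * y) ≠ 0 := by
      intro hzero
      rw [hzero, mul_zero] at hlin
      apply hdet
      linear_combination ((q0 * y + q1) * Y + (qt1 * Y + qt2)) * hzero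
        + (q0 * y + q1 - (qt0 * Y + qt1)) * hlin
    exact ⟨hden, eq_div_of_mul_eq hden hlin⟩

/-- A change of coordinates between two gauges of a regular ambitoric
structure, compatible with the conformal factor identity
`q(x,y)·(x̃(x) − ỹ(y)) = q̃(x̃(x), ỹ(y))·(x − y)`, is rational-linear in each variable. -/
theorem stmt_0 (q0 q1 q2 qt0 qt1 qt2 : ℝ)
    (I J : Set ℝ) (hIo : IsOpen I) (hIc : I.OrdConnected) (hIne : I.Nonempty)
    (hJo : IsOpen J) (hJc : J.OrdConnected) (hJne : J.Nonempty)
    (xt yt : ℝ → ℝ)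
    (hq : ∀ x ∈ I, ∀ y ∈ J, q0 * x * y + q1 * (x + y) + q2 ≠ 0)
    (hne : ∀ x ∈ I, ∀ y ∈ J, xt x ≠ yt y)
    (heq : ∀ x ∈ I, ∀ y ∈ J,
      (q0 * x * y + q1 * (x + y) + q2) * (xt x - yt y)
        = (qt0 * xt x * yt y + qt1 * (xt x + yt y) + qt2) * (x - y)) :
    (∃ a b c d : ℝ, a * d - b * c ≠ 0 ∧
      ∀ x ∈ I, c * x + d ≠ 0 ∧ xt x = (a * x + b) / (c * x + d)) ∧
    (∃ a b c d : ℝ, a * d - b * c ≠ 0 ∧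
      ∀ y ∈ J, c * y + d ≠ 0 ∧ yt y = (a * y + b) / (c * y + d)) := by
  refine ⟨exists_rational_linear_of_conformal_factor_eq hIo hIne hJo hJne hq hne heq,
    exists_rational_linear_of_conformal_factor_eq (q0 := q0) (q1 := q1) (q2 := q2)
      (qt0 := qt0) (qt1 := qt1) (qt2 := qt2) hJo hJne hIo hIne
      (fun y hy x hx h ↦ hq x hx y hy ?_) (fun y hy x hx ↦ (hne x hx y hy).symm)
      fun y hy x hx ↦ ?_⟩
  · linear_combination h
  · linear_combination -heq x hx y hy
end

section
/- Let q(z)=q₀z²+2q₁z+q₂ and q̃(z)=q̃₀z²+2q̃₁z+q̃₂ be real quadratic polynomials with polarizations q(x,y) and q̃(x,y). Let I, J ⊆ ℝ be disjoint nonempty open intervals, and let x̃ : I → ℝ and ỹ : J → ℝ be differentiable functions such that for all (x,y) ∈ I×J one has x̃(x) ≠ ỹ(y) and q(x,y)·(x̃(x) − ỹ(y)) = q̃(x̃(x), ỹ(y))·(x − y), and such that q(x,x) ≠ 0 for all x ∈ I and q(y,y) ≠ 0 for all y ∈ J. Then for all (x,y) ∈ I×J: (i) (x̃(x) − ỹ(y))²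 = (x − y)²·x̃′(x)·ỹ′(y); (ii) x̃′(x)·q(x,x) = q̃(x̃(x), x̃(x)); (iii) ỹ′(y)·q(y,y) = q̃(ỹ(y), ỹ(y)). -/
/-- Differentiating `q(x,y)(x̃ − ỹ) = q̃(x̃,ỹ)(x − y)` in `x` at fixed `y`, `ỹ = w`. -/
lemma polarization_deriv_relation {q0 q1 q2 r0 r1 r2 x y w X' : ℝ} {X : ℝ → ℝ}
    (hX : HasDerivAt X X' x) (hxy : x ≠ y)
    (h : ∀ᶠ s in nhds x, (q0 * s * y + q1 * (s + y) + q2) * (X s - w)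
      = (r0 * X s * w + r1 * (X s + w) + r2) * (s - y)) :
    (q0 * y ^ 2 + 2 * q1 * y + q2) * (X x - w) ^ 2
      = (r0 * w ^ 2 + 2 * r1 * w + r2) * X' * (x - y) ^ 2 := by
  have hid := hasDerivAt_id' x
  have hl := ((((hid.const_mul q0).mul_const y).add ((hid.add_const y).const_mul q1)).add_const
    q2).mul (hX.sub_const w)
  have hr := ((((hX.const_mul r0).mul_const w).add ((hX.add_const w).const_mul r1)).add_const
    r2).mul (hid.sub_const y)
  have hd := hl.unique (hr.congr_of_eventuallyEq h)
  have h0 := h.self_of_nhds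
  have hxy' : x - y ≠ 0 := sub_ne_zero.mpr hxy
  simp only [Pi.add_apply] at hd
  grind

/-- If `((x̃ − ỹ)/(x − y))²` separates as a product near `x`, in the sense that its ratio at two
values of `y` is locally constant in `x`, then the first-order cross-ratio relation holds. -/
lemma crossRatio_deriv_relation {x y z w v X' : ℝ} {X : ℝ → ℝ}
    (hX : HasDerivAt X X' x) (hy : x ≠ y) (hz : x ≠ z) (hw : X x ≠ w) (hv : X x ≠ v)
    (h : ∀ᶠ s in nhds x, ((X s - w) * (s - z)) ^ 2 * ((X x - v) * (x - y)) ^ 2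
      = ((X s - v) * (s - y)) ^ 2 * ((X x - w) * (x - z)) ^ 2) :
    X' * (x - y) * (x - z) * (w - v) = (X x - w) * (X x - v) * (y - z) := by
  have hid := hasDerivAt_id' x
  have hl := (((hX.sub_const w).mul (hid.sub_const z)).pow 2).mul_const
    (((X x - v) * (x - y)) ^ 2)
  have hr := (((hX.sub_const v).mul (hid.sub_const y)).pow 2).mul_const
    (((X x - w) * (x - z)) ^ 2)
  have hd := hl.unique (hr.congr_of_eventuallyEq h)
  have hy' := sub_ne_zero.mpr hy
  have hz' := sub_ne_zero.mpr hz
  have hw' := sub_ne_zero.mpr hw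
  have hv' := sub_ne_zero.mpr hv
  have hne : 2 * ((X x - w) * (X x - v) * (x - y) * (x - z)) ≠ 0 := by positivity
  apply mul_left_cancel₀ hne
  simp at hd
  linear_combination hd

/-- The derivative relations satisfied by a rational-linear change of
gauge of a regular ambitoric structure:
(i) `(x̃ − ỹ)² = (x − y)²·x̃′·ỹ′`, (ii) `x̃′·q(x,x) = q̃(x̃,x̃)`, (iii) `ỹ′·q(y,y) = q̃(ỹ,ỹ)`. -/
theorem stmt_1 (q0 q1 q2 qt0 qt1 qt2 : ℝ)
    (I J : Set ℝ) (hIo : IsOpen I) (hIc : I.OrdConnected) (hIne : I.Nonempty)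
    (hJo : IsOpen J) (hJc : J.OrdConnected) (hJne : J.Nonempty)
    (hdisj : Disjoint I J)
    (xt yt xt' yt' : ℝ → ℝ)
    (hxt : ∀ x ∈ I, HasDerivAt xt (xt' x) x)
    (hyt : ∀ y ∈ J, HasDerivAt yt (yt' y) y)
    (hne : ∀ x ∈ I, ∀ y ∈ J, xt x ≠ yt y)
    (heq : ∀ x ∈ I, ∀ y ∈ J,
      (q0 * x * y + q1 * (x + y) + q2) * (xt x - yt y)
        = (qt0 * xt x * yt y + qt1 * (xt x + yt y) + qt2) * (x - y))
    (hqI : ∀ x ∈ I, q0 * x ^ 2 + 2 * q1 * x + q2 ≠ 0)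
    (hqJ : ∀ y ∈ J, q0 * y ^ 2 + 2 * q1 * y + q2 ≠ 0) :
    ∀ x ∈ I, ∀ y ∈ J,
      (xt x - yt y) ^ 2 = (x - y) ^ 2 * (xt' x * yt' y) ∧
      xt' x * (q0 * x ^ 2 + 2 * q1 * x + q2)
        = qt0 * (xt x) ^ 2 + 2 * qt1 * xt x + qt2 ∧
      yt' y * (q0 * y ^ 2 + 2 * q1 * y + q2)
        = qt0 * (yt y) ^ 2 + 2 * qt1 * yt y + qt2 := by
  intro x hx y hy
  have hIJ : ∀ s ∈ I, ∀ t ∈ J, s ≠ t := fun s hs t ht => hdisj.ne_of_mem hs ht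
  have hA : ∀ s ∈ I, ∀ t ∈ J, (q0 * t ^ 2 + 2 * q1 * t + q2) * (xt s - yt t) ^ 2
      = (qt0 * yt t ^ 2 + 2 * qt1 * yt t + qt2) * xt' s * (s - t) ^ 2 := fun s hs t ht =>
    polarization_deriv_relation (hxt s hs) (hIJ s hs t ht)
      (Filter.eventually_of_mem (hIo.mem_nhds hs) fun u hu => heq u hu t ht)
  have hB : (q0 * x ^ 2 + 2 * q1 * x + q2) * (yt y - xt x) ^ 2
      = (qt0 * xt x ^ 2 + 2 * qt1 * xt x + qt2) * yt' y * (y - x) ^ 2 :=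
    polarization_deriv_relation (hyt y hy) (hIJ x hx y hy).symm
      (Filter.eventually_of_mem (hJo.mem_nhds hy) fun u hu => by
        linear_combination -heq x hx u hu)
  have hC : ∀ t ∈ J, xt' x * (x - t) * (x - y) * (yt t - yt y)
      = (xt x - yt t) * (xt x - yt y) * (t - y) := fun t ht =>
    crossRatio_deriv_relation (hxt x hx) (hIJ x hx t ht) (hIJ x hx y hy) (hne x hx t ht)
      (hne x hx y hy) (Filter.eventually_of_mem (hIo.mem_nhds hx) fun s hs => by
        apply mul_left_cancel₀ (mul_ne_zero (hqJ t ht) (hqJ y hy))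
        have h1 := congrArg₂ (· * ·) (hA s hs t ht) (hA x hx y hy)
        have h2 := congrArg₂ (· * ·) (hA s hs y hy) (hA x hx t ht)
        linear_combination (s - y) ^ 2 * (x - t) ^ 2 * h1 - (s - t) ^ 2 * (x - y) ^ 2 * h2)
  have hd : x - y ≠ 0 := sub_ne_zero.mpr (hIJ x hx y hy)
  have hD : xt x - yt y ≠ 0 := sub_ne_zero.mpr (hne x hx y hy)
  have hi : (xt x - yt y) ^ 2 = (x - y) ^ 2 * (xt' x * yt' y) := by
    have hid := hasDerivAt_id' y
    have hl := (((hid.const_sub x).const_mul (xt' x)).mul_const (x - y)).mul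
      ((hyt y hy).sub_const (yt y))
    have hr := (((hyt y hy).const_sub (xt x)).mul_const (xt x - yt y)).mul (hid.sub_const y)
    have h := hl.unique (hr.congr_of_eventuallyEq
      (Filter.eventually_of_mem (hJo.mem_nhds hy) hC))
    linear_combination -h
  have hprod : (x - y) ^ 2 * (xt' x * yt' y) ≠ 0 := hi ▸ pow_ne_zero 2 hD
  have hx' : xt' x ≠ 0 := fun h => hprod (by simp [h])
  have hy' : yt' y ≠ 0 := fun h => hprod (by simp [h])
  refine ⟨hi, ?_, ?_⟩
  · apply mul_left_cancel₀ (mul_ne_zero hy' (pow_ne_zero 2 hd))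
    linear_combination hB - (q0 * x ^ 2 + 2 * q1 * x + q2) * hi
  · apply mul_left_cancel₀ (mul_ne_zero hx' (pow_ne_zero 2 hd))
    linear_combination hA x hx y hy - (q0 * y ^ 2 + 2 * q1 * y + q2) * hi
end

section
/- Let a,b,c,d,a',b',c',d' ∈ ℝ with ad − bc ∈ {1, −1} and a'd' − b'c' ∈ {1, −1}, and suppose there exists ε ∈ {1, −1} such that (ax+b)(c'y+d') − (cx+d)(a'y+b') = ε(x − y) for all x, y ∈ ℝ. Then ad − bc = a'd' − b'c', and there exists σ ∈ {1, −1} such that a' = σa, b' = σb, c' = σc and d' = σd; in other words, the two matrices [[a,b],[c,d]] and [[a',b'],[c',d']] agree up to an overall sign, so the Möbius transformations x ↦ (ax+b)/(cx+d) and y ↦ (a'y+b')/(c'y+d') coincide. -/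
/-- Two Möbius transformations with determinants ±1 whose coefficients
satisfy `(ax+b)(c'y+d') − (cx+d)(a'y+b') = ε(x − y)` for all x, y agree up to an
overall sign; in particular their determinants are equal. -/
theorem stmt_2 (a b c d a' b' c' d' : ℝ)
    (h1 : a * d - b * c = 1 ∨ a * d - b * c = -1)
    (h2 : a' * d' - b' * c' = 1 ∨ a' * d' - b' * c' = -1)
    (h3 : ∃ ε : ℝ, (ε = 1 ∨ ε = -1) ∧
      ∀ x y : ℝ, (a * x + b) * (c' * y + d') - (c * x + d) * (a' * y + b') = ε * (x - y)) :
    a * d - b * c = a' * d' - b' * c' ∧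
    ∃ σ : ℝ, (σ = 1 ∨ σ = -1) ∧ a' = σ * a ∧ b' = σ * b ∧ c' = σ * c ∧ d' = σ * d := by
  obtain ⟨ε, hε, h⟩ := h3
  have h00 : b * d' - d * b' = 0 := by linear_combination h 0 0
  have h10 : a * d' - c * b' = ε := by linear_combination h 1 0 - h 0 0
  have h01 : b * c' - d * a' = -ε := by linear_combination h 0 1 - h 0 0
  have h11 : a * c' - c * a' = 0 := by linear_combination h 1 1 - h 1 0 - h 0 1 + h 0 0
  have hD : (a * d - b * c) ^ 2 = 1 := sq_eq_one_iff.mpr h1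
  have hε2 : ε ^ 2 = 1 := sq_eq_one_iff.mpr hε
  have ha : a' = ε * (a * d - b * c) * a := by
    linear_combination (a * d - b * c) * (b * h11 - a * h01) - a' * hD
  have hb : b' = ε * (a * d - b * c) * b := by
    linear_combination (a * d - b * c) * (b * h10 - a * h00) - b' * hD
  have hc : c' = ε * (a * d - b * c) * c := by
    linear_combination (a * d - b * c) * (d * h11 - c * h01) - c' * hD
  have hd : d' = ε * (a * d - b * c) * d := by
    linear_combination (a * d - b * c) * (d * h10 - c * h00) - d' * hD
  refine ⟨?_, ε * (a * d - b * c), ?_, ha, hb, hc, hd⟩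
  · rw [ha, hb, hc, hd]
    linear_combination -(a * d - b * c) * (ε ^ 2 * hD + hε2)
  · rw [← sq_eq_one_iff, mul_pow, hε2, hD, one_mul]
end

section
/- Let x₀ < x₁ and y₀ < y₁ be real numbers with [x₀,x₁] ∩ [y₀,y₁] = ∅, let A : (x₀,x₁) → (0,∞) and B : (y₀,y₁) → (0,∞) be smooth positive functions, and let U = (x₀,x₁) × (y₀,y₁) × ℝ². For a piecewise continuously differentiable curve γ = (x, y, t₁, t₂) : [0,1) → U define its g₀-length L(γ) = ∫₀¹ √( x′²/A(x) + y′²/B(y) + ( A(x)(t₁′ + y t₂′)² + B(y)(t₁′ + x t₂′)² )/(x − y)² ) dτ ∈ [0,∞]. Then every piecewise continuously differentiable curve γ : [0,1) → U with x(τ) → x₀ as τ → 1⁻ has L(γ) = ∞ if and only if ∫_{x₀}^{x₀+ε} dx/√(A(x)) = ∞ for every ε ∈ (0, x₁ − x₀). -/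
open Set MeasureTheory Filter

/-- If `x : [0,1) → (a,b)` is piecewise `C¹` and tends to `a`, then the integral of a nonnegative
continuous density over `(a, x 0)` is at most the integral of its pull-back along `x`. -/
lemma lintegral_Ioo_le_lintegral_abs_deriv_mul_comp {a b : ℝ} {f x x' : ℝ → ℝ} {S : Set ℝ}
    (hS : S.Countable) (hf : ContinuousOn f (Ioo a b)) (hf0 : ∀ s ∈ Ioo a b, 0 ≤ f s)
    (hx : ContinuousOn x (Ico 0 1))
    (hx' : ∀ τ ∈ Ico (0 : ℝ) 1 \ S, HasDerivWithinAt x (x' τ) (Ico 0 1) τ)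
    (hcx' : ContinuousOn x' (Ico 0 1 \ S))
    (hmem : ∀ τ ∈ Ico (0 : ℝ) 1, x τ ∈ Ioo a b)
    (hlim : Tendsto x (nhdsWithin 1 (Iio 1)) (nhds a)) :
    ∫⁻ s in Ioo a (x 0), ENNReal.ofReal (f s) ≤
      ∫⁻ τ in Ico (0 : ℝ) 1, ENNReal.ofReal (|x' τ| * f (x τ)) := by
  set c := x 0
  set L := ∫⁻ τ in Ico (0 : ℝ) 1, ENNReal.ofReal (|x' τ| * f (x τ))
  have hc : c ∈ Ioo a b := hmem 0 (by simp)
  rcases eq_or_ne L ⊤ with hL | hL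
  · rw [hL]; exact le_top
  have hfi : ∀ {u v : ℝ}, u ∈ Ioo a b → v ∈ Ioo a b → IntervalIntegrable f volume u v :=
    fun hu hv => (hf.mono (ordConnected_Ioo.uIcc_subset hu hv)).intervalIntegrable
  let F : ℝ → ℝ := fun u => ∫ s in u..c, f s
  have hF : ∀ u ∈ Ioo a b, HasDerivAt F (-f u) u := fun u hu =>
    intervalIntegral.integral_hasDerivAt_left (hfi hu hc)
      (hf.stronglyMeasurableAtFilter isOpen_Ioo u hu) (hf.continuousAt (Ioo_mem_nhds hu.1 hu.2))
  let g : ℝ → ℝ := fun τ => -f (x τ) * x' τ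
  have hg_enorm : ∀ τ ∈ Ico (0 : ℝ) 1, ‖g τ‖ₑ = ENNReal.ofReal (|x' τ| * f (x τ)) := by
    intro τ hτ
    rw [← ofReal_norm]
    simp only [g, norm_mul, norm_neg, Real.norm_eq_abs, abs_of_nonneg (hf0 _ (hmem τ hτ))]
    rw [mul_comm]
  have hg_lint : ∫⁻ τ in Ico (0 : ℝ) 1, ‖g τ‖ₑ = L :=
    setLIntegral_congr_fun measurableSet_Ico hg_enorm
  have hg_int : IntegrableOn g (Ico 0 1) := by
    refine ⟨?_, ?_⟩
    · have hcont : ContinuousOn g (Ico 0 1 \ S) :=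
        ((hf.comp (hx.mono sdiff_subset) fun τ hτ => hmem τ hτ.1).neg).mul hcx'
      have := hcont.aestronglyMeasurable (μ := volume) (measurableSet_Ico.diff hS.measurableSet)
      rwa [Measure.restrict_congr_set (sdiff_null_ae_eq_self (hS.measure_zero volume))] at this
    · rw [HasFiniteIntegral, hg_lint]
      exact hL.lt_top
  have hbound : ∀ T ∈ Ico (0 : ℝ) 1, ∫⁻ s in Icc (x T) c, ENNReal.ofReal (f s) ≤ L := by
    intro T hT
    rcases lt_or_ge c (x T) with h | h
    · simp [Icc_eq_empty_of_lt h]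
    have hsub : Icc (0 : ℝ) T ⊆ Ico 0 1 := Icc_subset_Ico_right hT.2
    have hftc : ∫ τ in (0 : ℝ)..T, g τ = F (x T) - F (x 0) := by
      refine integral_eq_of_hasDerivAt_off_countable_of_le (fun τ => F (x τ)) g hT.1 hS ?_ ?_ ?_
      · intro τ hτ
        exact ((hF _ (hmem τ (hsub hτ))).continuousAt.comp_continuousWithinAt (hx τ (hsub hτ))).mono
          hsub
      · intro τ hτ
        have hτ' : τ ∈ Ico (0 : ℝ) 1 := hsub (Ioo_subset_Icc_self hτ.1)
        exact (hF _ (hmem τ hτ')).comp τ ((hx' τ ⟨hτ', hτ.2⟩).hasDerivAt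
          (Ico_mem_nhds hτ.1.1 hτ'.2))
      · rw [intervalIntegrable_iff_integrableOn_Icc_of_le hT.1]
        exact hg_int.mono_set hsub
    have hF0 : F (x 0) = 0 := intervalIntegral.integral_same
    have hIcc : Icc (x T) c ⊆ Ioo a b := ordConnected_Ioo.out (hmem T hT) hc
    have hFx : ENNReal.ofReal (F (x T)) = ∫⁻ s in Icc (x T) c, ENNReal.ofReal (f s) := by
      simp only [F]
      rw [intervalIntegral.integral_of_le h, ← integral_Icc_eq_integral_Ioc]
      refine ofReal_integral_eq_lintegral_ofReal ?_ ?_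
      · exact (intervalIntegrable_iff_integrableOn_Icc_of_le h).1 (hfi (hmem T hT) hc)
      · exact (ae_restrict_iff' measurableSet_Icc).2 (ae_of_all _ fun s hs => hf0 s (hIcc hs))
    calc ∫⁻ s in Icc (x T) c, ENNReal.ofReal (f s) = ENNReal.ofReal (∫ τ in Icc 0 T, g τ) := by
          rw [← hFx, integral_Icc_eq_integral_Ioc, ← intervalIntegral.integral_of_le hT.1, hftc,
            hF0, sub_zero]
      _ ≤ ‖∫ τ in Icc 0 T, g τ‖ₑ := by
          rw [← ofReal_norm]
          exact ENNReal.ofReal_le_ofReal (le_abs_self _)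
      _ ≤ ∫⁻ τ in Icc 0 T, ‖g τ‖ₑ := enorm_integral_le_lintegral_enorm _
      _ ≤ L := hg_lint ▸ lintegral_mono_set hsub
  have hcover : AECover (volume.restrict (Ioo a c)) (nhdsWithin (1 : ℝ) (Iio 1))
      fun T => Icc (x T) c := aecover_Ioo_of_Icc hlim tendsto_const_nhds
  have hmeas : AEMeasurable (fun s => ENNReal.ofReal (f s)) (volume.restrict (Ioo a c)) :=
    ((hf.mono (Ioo_subset_Ioo_right hc.2.le)).aemeasurable measurableSet_Ioo).ennreal_ofReal
  refine le_of_tendsto (hcover.lintegral_tendsto_of_countably_generated hmeas) ?_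
  filter_upwards [Ico_mem_nhdsLT (zero_lt_one' ℝ)] with T hT
  refine le_trans (lintegral_mono' ?_ le_rfl) (hbound T hT)
  exact Measure.restrict_mono_measure Measure.restrict_le_self _

/-- Affine change of variables along the segment from `a + ε` down to `a`. -/
lemma lintegral_Ico_ofReal_mul_comp_le (f : ℝ → ℝ) (a : ℝ) {ε : ℝ} (hε : 0 < ε) :
    ∫⁻ τ in Ico (0 : ℝ) 1, ENNReal.ofReal (ε * f (a + ε * (1 - τ))) ≤
      ∫⁻ s in Ioo a (a + ε), ENNReal.ofReal (f s) := by
  have hderiv : ∀ τ ∈ Ico (0 : ℝ) 1,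
      HasDerivWithinAt (fun τ => a + ε * (1 - τ)) (-ε) (Ico 0 1) τ := fun τ _ => by
    simpa using ((((hasDerivAt_id τ).const_sub 1).const_mul ε).const_add a).hasDerivWithinAt
  have hinj : InjOn (fun τ : ℝ => a + ε * (1 - τ)) (Ico 0 1) := fun u _ v _ h => by
    have := mul_left_cancel₀ hε.ne' (add_left_cancel h)
    linarith
  have himage : (fun τ : ℝ => a + ε * (1 - τ)) '' Ico 0 1 ⊆ Ioc a (a + ε) := by
    rintro _ ⟨τ, hτ, rfl⟩
    constructor <;> nlinarith [hτ.1, hτ.2]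
  have hcv := lintegral_image_eq_lintegral_abs_deriv_mul measurableSet_Ico hderiv hinj
    fun s => ENNReal.ofReal (f s)
  simp only [abs_neg, abs_of_pos hε, ← ENNReal.ofReal_mul hε.le] at hcv
  rw [← hcv, restrict_Ioo_eq_restrict_Ioc]
  exact lintegral_mono_set himage

/-- For the parabolic barycentric metric
`g₀ = dx²/A(x) + dy²/B(y) + A(x)(dt₁+y dt₂)²/(x−y)² + B(y)(dt₁+x dt₂)²/(x−y)²`
on `(x₀,x₁)×(y₀,y₁)×ℝ²`, every piecewise C¹ curve with `x(τ) → x₀` has infinite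
`g₀`-length if and only if `∫_{x₀}^{x₀+ε} dx/√A(x) = ∞` for every `ε ∈ (0, x₁−x₀)`. -/
theorem stmt_4 (x0 x1 y0 y1 : ℝ) (hx : x0 < x1) (hy : y0 < y1)
    (hdisj : Disjoint (Icc x0 x1) (Icc y0 y1))
    (A B : ℝ → ℝ)
    (hA_smooth : ContDiffOn ℝ (⊤ : ℕ∞) A (Ioo x0 x1))
    (hA_pos : ∀ x ∈ Ioo x0 x1, 0 < A x)
    (hB_smooth : ContDiffOn ℝ (⊤ : ℕ∞) B (Ioo y0 y1))
    (hB_pos : ∀ y ∈ Ioo y0 y1, 0 < B y) :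
    (∀ (x y t1 t2 x' y' t1' t2' : ℝ → ℝ) (S : Finset ℝ),
      ContinuousOn x (Ico 0 1) → ContinuousOn y (Ico 0 1) →
      ContinuousOn t1 (Ico 0 1) → ContinuousOn t2 (Ico 0 1) →
      (∀ τ ∈ Ico (0:ℝ) 1 \ (S : Set ℝ),
        HasDerivWithinAt x (x' τ) (Ico 0 1) τ ∧ HasDerivWithinAt y (y' τ) (Ico 0 1) τ ∧
        HasDerivWithinAt t1 (t1' τ) (Ico 0 1) τ ∧
        HasDerivWithinAt t2 (t2' τ) (Ico 0 1) τ) →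
      ContinuousOn x' (Ico 0 1 \ (S : Set ℝ)) →
      ContinuousOn y' (Ico 0 1 \ (S : Set ℝ)) →
      ContinuousOn t1' (Ico 0 1 \ (S : Set ℝ)) →
      ContinuousOn t2' (Ico 0 1 \ (S : Set ℝ)) →
      (∀ τ ∈ Ico (0:ℝ) 1, x τ ∈ Ioo x0 x1 ∧ y τ ∈ Ioo y0 y1) →
      Tendsto x (nhdsWithin 1 (Iio 1)) (nhds x0) →
      ∫⁻ τ in Ico (0:ℝ) 1, ENNReal.ofReal (Real.sqrt
        ((x' τ) ^ 2 / A (x τ) + (y' τ) ^ 2 / B (y τ) +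
          (A (x τ) * (t1' τ + y τ * t2' τ) ^ 2 + B (y τ) * (t1' τ + x τ * t2' τ) ^ 2)
            / (x τ - y τ) ^ 2)) = ⊤)
    ↔ (∀ ε ∈ Ioo (0:ℝ) (x1 - x0),
        ∫⁻ s in Ioo x0 (x0 + ε), ENNReal.ofReal (1 / Real.sqrt (A s)) = ⊤) := by
  constructor
  · intro h ε hε
    have hy' : (y0 + y1) / 2 ∈ Ioo y0 y1 := ⟨by linarith, by linarith⟩
    have hmem : ∀ τ ∈ Ico (0 : ℝ) 1, x0 + ε * (1 - τ) ∈ Ioo x0 x1 := fun τ hτ =>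
      ⟨by nlinarith [hτ.2, hε.1], by nlinarith [hτ.1, hε.1, hε.2]⟩
    have hlen := h (fun τ => x0 + ε * (1 - τ)) (fun _ => (y0 + y1) / 2) 0 0 (fun _ => -ε) 0 0 0 ∅
      (by fun_prop) continuousOn_const continuousOn_const continuousOn_const
      (fun τ _ => ⟨by
        simpa using ((((hasDerivAt_id τ).const_sub 1).const_mul ε).const_add x0).hasDerivWithinAt,
        hasDerivWithinAt_const .., hasDerivWithinAt_const .., hasDerivWithinAt_const ..⟩)
      continuousOn_const continuousOn_const continuousOn_const continuousOn_const
      (fun τ hτ => ⟨hmem τ hτ, hy'⟩)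
      (tendsto_nhdsWithin_of_tendsto_nhds (by
        have : Continuous fun τ : ℝ => x0 + ε * (1 - τ) := by fun_prop
        simpa using this.tendsto 1))
    rw [eq_top_iff, ← hlen]
    refine le_trans (le_of_eq ?_)
      (lintegral_Ico_ofReal_mul_comp_le (fun s => 1 / Real.sqrt (A s)) x0 hε.1)
    refine lintegral_congr fun τ => ?_
    simp [Real.sqrt_mul (sq_nonneg ε), Real.sqrt_sq hε.1.le, div_eq_mul_inv]
  · intro h x y t1 t2 x' y' t1' t2' S hx _ _ _ hd hcx' _ _ _ hmem hlim
    have hx0 := (hmem 0 (by simp)).1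
    have hint := h (x 0 - x0) ⟨by linarith [hx0.1], by linarith [hx0.2]⟩
    rw [add_sub_cancel] at hint
    have hcont : ContinuousOn (fun s => 1 / Real.sqrt (A s)) (Ioo x0 x1) :=
      continuousOn_const.div hA_smooth.continuousOn.sqrt
        fun s hs => (Real.sqrt_pos.2 (hA_pos s hs)).ne'
    rw [eq_top_iff, ← hint]
    refine (lintegral_Ioo_le_lintegral_abs_deriv_mul_comp S.countable_toSet hcont
      (fun s _ => by positivity) hx (fun τ hτ => (hd τ hτ).1) hcx' (fun τ hτ => (hmem τ hτ).1)
      hlim).trans (setLIntegral_mono' measurableSet_Ico fun τ hτ => ENNReal.ofReal_le_ofReal ?_)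
    have hA := hA_pos _ (hmem τ hτ).1
    have hB := hB_pos _ (hmem τ hτ).2
    rw [mul_one_div, ← Real.sqrt_sq_eq_abs, ← Real.sqrt_div (sq_nonneg _), add_assoc]
    exact Real.sqrt_le_sqrt (le_add_of_nonneg_right (by positivity))
end

section
/- Let n ≥ 1, let X be a connected Hausdorff topological space, and let Ψ : X → ℝⁿ be a continuous map such that every x ∈ X admits arbitrarily small open neighbourhoods U_x on which Ψ is injective, together with a closed convex cone C_x ⊆ ℝⁿ with vertex Ψ(x), such that Ψ(U_x) is a neighbourhood of Ψ(x) in C_x and Ψ|_{U_x} : U_x → C_x is an open map (for the subspace topology on C_x). For x, y ∈ X let d(x,y) be the infimum of the total variations of Ψ∘γ over all continuous curves γ : [0,1] → X with γ(0) = x and γ(1) = y. Assume d(x,y) is finite for all x,y, that d(x,y) = 0 implies x = y, and that (X, d) is a complete metric space. Then Ψ(X) is a convex subset of ℝⁿ and Ψ is injective. -/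
open Set Filter
open scoped ENNReal

/-- The infimum over all continuous curves `γ : [0,1] → X` from `x` to `y` of the
total variation of `Ψ ∘ γ` on `[0,1]`. -/
noncomputable def curveDist {X : Type*} [TopologicalSpace X] {E : Type*}
    [PseudoEMetricSpace E] (Ψ : X → E) (x y : X) : ℝ≥0∞ :=
  ⨅ γ ∈ {γ : ℝ → X | ContinuousOn γ (Set.Icc 0 1) ∧ γ 0 = x ∧ γ 1 = y},
    eVariationOn (Ψ ∘ γ) (Set.Icc 0 1)

/-- A map from a complete length space which is, near each point, an isometry onto a
neighbourhood of its image in a closed convex set. -/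
structure IsLocallyConvexMap {M E : Type*} [MetricSpace M] [NormedAddCommGroup E]
    [NormedSpace ℝ E] (Ψ : M → E) : Prop where
  exists_between : ∀ x y : M, ∀ s : ℝ, 0 ≤ s → s ≤ dist x y → ∀ ε > 0,
    ∃ z, dist x z = s ∧ dist z y < dist x y - s + ε
  exists_chart : ∀ x : M, ∃ r > 0, ∃ C : Set E, IsClosed C ∧ Convex ℝ C ∧
    (∀ p, dist x p ≤ r → Ψ p ∈ C) ∧
    (∀ p q, dist x p ≤ r → dist x q ≤ r → dist (Ψ p) (Ψ q) = dist p q) ∧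
    (∀ e ∈ C, dist (Ψ x) e ≤ r → ∃ p, dist x p ≤ r ∧ Ψ p = e)
  complete : ∀ u : ℕ → M,
    (∀ ε : ℝ, 0 < ε → ∃ N : ℕ, ∀ m ≥ N, ∀ l ≥ N, dist (u m) (u l) < ε) →
    ∃ x : M, Tendsto (fun i => dist (u i) x) atTop (nhds 0)

/-- `w` lies between `u` and `y`, and the displacement of `Ψ` from `u` to `w` is
`dist u w` times `v`. -/
def StraightTo {M E : Type*} [MetricSpace M] [NormedAddCommGroup E] [NormedSpace ℝ E]
    (Ψ : M → E) (y : M) (v : E) (u w : M) : Prop :=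
  dist u w + dist w y = dist u y ∧ Ψ w - Ψ u = dist u w • v

/-- `z` is a limit of points, distinct from it, from which it is reached in a straight way. -/
def StraightLimit {M E : Type*} [MetricSpace M] [NormedAddCommGroup E] [NormedSpace ℝ E]
    (Ψ : M → E) (y : M) (v : E) (z : M) : Prop :=
  ∀ ε > 0, ∃ u, u ≠ z ∧ dist u z < ε ∧ StraightTo Ψ y v u z

section Abstract

variable {M E : Type*} [MetricSpace M] [NormedAddCommGroup E] [NormedSpace ℝ E]
  {Ψ : M → E} {x y z w u : M} {v : E}

theorem StraightTo.refl (Ψ : M → E) (y : M) (v : E) (u : M) : StraightTo Ψ y v u u := by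
  simp [StraightTo]

theorem StraightTo.dist_eq (h₁ : StraightTo Ψ y v u z) (h₂ : StraightTo Ψ y v z w) :
    dist u w = dist u z + dist z w := by
  have := dist_triangle u w y
  have := dist_triangle u z w
  linarith [h₁.1, h₂.1]

theorem StraightTo.trans (h₁ : StraightTo Ψ y v u z) (h₂ : StraightTo Ψ y v z w) :
    StraightTo Ψ y v u w := by
  have h := h₁.dist_eq h₂
  refine ⟨by linarith [h₁.1, h₂.1], ?_⟩
  rw [h, add_smul, ← h₁.2, ← h₂.2]
  abel

theorem StraightTo.eq_of_symm (h₁ : StraightTo Ψ y v u w) (h₂ : StraightTo Ψ y v w u) :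
    u = w := by
  rw [← dist_eq_zero]
  have := h₂.1
  rw [dist_comm w u] at this
  linarith [h₁.1]

theorem IsLocallyConvexMap.continuous (hΨ : IsLocallyConvexMap Ψ) : Continuous Ψ := by
  rw [continuous_iff_continuousAt]
  intro x
  obtain ⟨r, hr, C, -, -, -, hiso, -⟩ := hΨ.exists_chart x
  rw [Metric.continuousAt_iff]
  intro ε hε
  refine ⟨min ε r, lt_min hε hr, fun {p} hp => ?_⟩
  rw [hiso p x (by rw [dist_comm]; exact (hp.trans_le (min_le_right _ _)).le)
    (by simpa using hr.le)]
  exact hp.trans_le (min_le_left _ _)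

/-- Near `z` there are points at prescribed distance lying exactly between `z` and `y`,
and the pieces from `z` to them are straight. -/
theorem IsLocallyConvexMap.exists_step [ProperSpace E] (hΨ : IsLocallyConvexMap Ψ) (z y : M) :
    ∃ r > 0, (∀ p q, dist z p ≤ r → dist z q ≤ r → dist (Ψ p) (Ψ q) = dist p q) ∧
      ∀ s, 0 < s → s ≤ r → s ≤ dist z y →
        ∃ w, dist z w = s ∧ dist z w + dist w y = dist z y ∧
          ∀ v : E, Ψ w - Ψ z = s • v → StraightLimit Ψ y v w := by
  obtain ⟨r, hr, C, hCc, hC, hmem, hiso, hsurj⟩ := hΨ.exists_chart z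
  refine ⟨r, hr, hiso, fun s hs hsr hsy => ?_⟩
  have himage : Ψ '' Metric.closedBall z r = C ∩ Metric.closedBall (Ψ z) r := by
    ext e
    constructor
    · rintro ⟨p, hp, rfl⟩
      rw [Metric.mem_closedBall, dist_comm] at hp
      refine ⟨hmem p hp, ?_⟩
      rwa [Metric.mem_closedBall, dist_comm, hiso z p (by simpa using hr.le) hp]
    · rintro ⟨he, her⟩
      rw [Metric.mem_closedBall, dist_comm] at her
      obtain ⟨p, hp, rfl⟩ := hsurj e he her
      exact ⟨p, by rwa [Metric.mem_closedBall, dist_comm], rfl⟩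
  have hball : IsCompact (Metric.closedBall z r) := by
    have hisom : Isometry ((Metric.closedBall z r).domRestrict Ψ) := by
      refine Isometry.of_dist_eq fun p q => hiso p q ?_ ?_
      · rw [dist_comm]; exact p.2
      · rw [dist_comm]; exact q.2
    rw [isCompact_iff_isCompact_univ, hisom.isEmbedding.isCompact_iff, image_univ,
      range_domRestrict, himage]
    exact (isCompact_closedBall _ _).inter_left hCc
  have hsphere : IsCompact (Metric.sphere z s) :=
    hball.of_isClosed_subset Metric.isClosed_sphere
      (Metric.sphere_subset_closedBall.trans (Metric.closedBall_subset_closedBall hsr))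
  obtain ⟨w₀, hw₀, -⟩ := hΨ.exists_between z y s hs.le hsy 1 one_pos
  obtain ⟨w, hw, hmin⟩ := hsphere.exists_isMinOn ⟨w₀, by rwa [Metric.mem_sphere, dist_comm]⟩
    (f := fun p => dist p y) (by fun_prop)
  rw [Metric.mem_sphere, dist_comm] at hw
  have hwy : dist z w + dist w y = dist z y := by
    refine le_antisymm ?_ (dist_triangle _ _ _)
    refine le_of_forall_pos_le_add fun ε hε => ?_
    obtain ⟨p, hp, hpy⟩ := hΨ.exists_between z y s hs.le hsy ε hε
    have : dist w y ≤ dist p y := hmin (by rwa [Metric.mem_sphere, dist_comm])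
    linarith
  refine ⟨w, hw, hwy, fun v hv ε hε => ?_⟩
  have hnorm : s * ‖v‖ = s := by
    have := hiso w z (by linarith) (by simpa using hr.le)
    rw [dist_eq_norm, hv, norm_smul, Real.norm_of_nonneg hs.le, dist_comm, hw] at this
    exact this
  have hv1 : ‖v‖ = 1 := by
    have : s * ‖v‖ = s * 1 := by rw [hnorm, mul_one]
    exact mul_left_cancel₀ hs.ne' this
  obtain ⟨δ, hδ, hδε⟩ := _root_.exists_between (lt_min hε hs)
  have hδs : δ < s := hδε.trans_le (min_le_right _ _)
  have hmemC : Ψ z + (s - δ) • v ∈ C := by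
    have h := hC.add_smul_sub_mem (hmem z (by simpa using hr.le)) (hmem w (by linarith))
      (t := (s - δ) / s) ⟨by apply div_nonneg <;> linarith, by rw [div_le_one hs]; linarith⟩
    rwa [hv, smul_smul, div_mul_cancel₀ _ hs.ne'] at h
  obtain ⟨p, hp, hpe⟩ := hsurj _ hmemC (by
    rw [dist_self_add_right, norm_smul, hv1, Real.norm_of_nonneg (by linarith)]; linarith)
  have hzp : dist z p = s - δ := by
    rw [← hiso z p (by simpa using hr.le) hp, hpe, dist_self_add_right, norm_smul, hv1,
      Real.norm_of_nonneg (by linarith), mul_one]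
  have hdiff : Ψ w - Ψ p = δ • v := by
    rw [hpe, ← sub_sub, hv, ← sub_smul]
    congr 1
    ring
  have hpw : dist p w = δ := by
    rw [← hiso p w hp (by linarith), dist_comm, dist_eq_norm, hdiff, norm_smul, hv1,
      Real.norm_of_nonneg hδ.le, mul_one]
  refine ⟨p, ?_, ?_, ?_, ?_⟩
  · rw [← dist_pos]; linarith
  · rw [hpw]; exact hδε.trans_le (min_le_left _ _)
  · have := dist_triangle z p y
    have := dist_triangle p w y
    linarith
  · rw [hpw, hdiff]

theorem IsLocallyConvexMap.exists_straight_step [ProperSpace E] [StrictConvexSpace ℝ E]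
    (hΨ : IsLocallyConvexMap Ψ) (hz : StraightLimit Ψ y v z) {T : ℝ} (hT : 0 < T)
    (hTy : T ≤ dist z y) :
    ∃ w, w ≠ z ∧ dist z w ≤ T ∧ StraightTo Ψ y v z w ∧ StraightLimit Ψ y v w := by
  obtain ⟨r, hr, hiso, hstep⟩ := hΨ.exists_step z y
  obtain ⟨w, hzw, hwy, hlim⟩ := hstep (min r T) (lt_min hr hT) (min_le_left _ _)
    ((min_le_right _ _).trans hTy)
  obtain ⟨u, huz, hur, huy, huv⟩ := hz r hr
  have huw : dist u w = dist u z + dist z w := by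
    have := dist_triangle u w y
    have := dist_triangle u z w
    linarith
  have hur' : dist z u ≤ r := by rw [dist_comm]; exact hur.le
  have hzr : dist z z ≤ r := by simpa using hr.le
  have hwr : dist z w ≤ r := hzw.trans_le (min_le_left _ _)
  have h₁ : ‖Ψ z - Ψ u‖ = dist u z := by rw [← dist_eq_norm, hiso z u hzr hur', dist_comm]
  have h₂ : ‖Ψ w - Ψ z‖ = dist z w := by rw [← dist_eq_norm, hiso w z hwr hzr, dist_comm]
  have h₃ : ‖(Ψ z - Ψ u) + (Ψ w - Ψ z)‖ = ‖Ψ z - Ψ u‖ + ‖Ψ w - Ψ z‖ := by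
    rw [h₁, h₂, ← huw, ← hiso u w hur' hwr, dist_comm, dist_eq_norm]
    congr 1
    abel
  have h₄ := (sameRay_iff_norm_add.2 h₃).norm_smul_eq
  rw [h₁, h₂, huv, smul_comm] at h₄
  have h₅ : Ψ w - Ψ z = dist z w • v :=
    smul_right_injective E (dist_pos.2 huz).ne' h₄
  refine ⟨w, ?_, hzw.trans_le (min_le_right _ _), ⟨hwy, h₅⟩, hlim v (hzw ▸ h₅)⟩
  rw [ne_comm, ← dist_pos, hzw]
  exact lt_min hr hT

/-- A chain of straight limits, straight from `x`, has a straight limit as an upper bound. -/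
theorem IsLocallyConvexMap.exists_upper_bound (hΨ : IsLocallyConvexMap Ψ) {c : Set M}
    (hc : c.Nonempty) {T : ℝ}
    (hcS : ∀ a ∈ c, StraightTo Ψ y v x a ∧ StraightLimit Ψ y v a ∧ dist x a ≤ T)
    (hchain : ∀ a ∈ c, ∀ b ∈ c, StraightTo Ψ y v a b ∨ StraightTo Ψ y v b a) :
    ∃ z, StraightTo Ψ y v x z ∧ StraightLimit Ψ y v z ∧ dist x z ≤ T ∧
      ∀ a ∈ c, StraightTo Ψ y v a z := by
  have hdist : ∀ a ∈ c, ∀ b ∈ c, StraightTo Ψ y v a b → dist a b = dist x b - dist x a :=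
    fun a ha b hb h => by linarith [(hcS a ha).1.dist_eq h]
  have habs : ∀ a ∈ c, ∀ b ∈ c, dist a b = |dist x a - dist x b| := by
    intro a ha b hb
    rcases hchain a ha b hb with h | h
    · rw [abs_sub_comm, ← hdist a ha b hb h, abs_of_nonneg dist_nonneg]
    · rw [← hdist b hb a ha h, abs_of_nonneg dist_nonneg, dist_comm]
  by_cases hmax : ∃ m ∈ c, ∀ a ∈ c, dist x a ≤ dist x m
  · obtain ⟨m, hm, hmax⟩ := hmax
    refine ⟨m, (hcS m hm).1, (hcS m hm).2.1, (hcS m hm).2.2, fun a ha => ?_⟩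
    rcases hchain a ha m hm with h | h
    · exact h
    · have : dist m a = 0 := le_antisymm (by linarith [hdist m hm a ha h, hmax a ha]) dist_nonneg
      rw [dist_eq_zero.1 this]
      exact StraightTo.refl _ _ _ _
  push Not at hmax
  have hbdd : BddAbove (dist x '' c) := ⟨T, by rintro _ ⟨a, ha, rfl⟩; exact (hcS a ha).2.2⟩
  obtain ⟨t, -, htlim, htmem⟩ := exists_seq_tendsto_sSup (hc.image _) hbdd
  choose s hs hst using htmem
  have htc : CauchySeq t := htlim.cauchySeq
  obtain ⟨z, hz⟩ := hΨ.complete s fun ε hε => by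
    obtain ⟨N, hN⟩ := Metric.cauchySeq_iff.1 htc ε hε
    refine ⟨N, fun m hm l hl => ?_⟩
    rw [habs _ (hs m) _ (hs l), hst, hst, ← Real.dist_eq]
    exact hN m hm l hl
  have hsz : Tendsto s atTop (nhds z) := tendsto_iff_dist_tendsto_zero.2 hz
  have hub : ∀ a ∈ c, StraightTo Ψ y v a z := by
    intro a ha
    obtain ⟨b, hb, hab⟩ := hmax a ha
    have hev : ∀ᶠ n in atTop, StraightTo Ψ y v a (s n) := by
      have hlt : dist x a < sSup (dist x '' c) := hab.trans_le (le_csSup hbdd ⟨b, hb, rfl⟩)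
      filter_upwards [htlim.eventually (lt_mem_nhds hlt)] with n hn
      rcases hchain a ha _ (hs n) with h | h
      · exact h
      · have h₁ := hdist _ (hs n) a ha h
        have h₂ : 0 ≤ dist (s n) a := dist_nonneg
        rw [hst] at h₁
        linarith
    have hcont : Tendsto (fun n => Ψ (s n)) atTop (nhds (Ψ z)) :=
      (hΨ.continuous.tendsto z).comp hsz
    have hda : Tendsto (fun n => dist a (s n)) atTop (nhds (dist a z)) :=
      tendsto_const_nhds.dist hsz
    constructor
    · refine tendsto_nhds_unique_of_eventuallyEq (hda.add (hsz.dist tendsto_const_nhds))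
        tendsto_const_nhds (hev.mono fun n h => h.1)
    · exact tendsto_nhds_unique_of_eventuallyEq (hcont.sub_const _) (hda.smul_const v)
        (hev.mono fun n h => h.2)
  refine ⟨z, (hcS _ (hs 0)).1.trans (hub _ (hs 0)), fun ε hε => ?_, ?_, hub⟩
  · obtain ⟨n, hn⟩ := (hz.eventually (gt_mem_nhds hε)).exists
    refine ⟨s n, fun h => ?_, hn, hub _ (hs n)⟩
    obtain ⟨b, hb, hlt⟩ := hmax _ (hs n)
    have := (hcS _ (hs n)).1.dist_eq (hub _ (hs n))
    have := (hcS _ hb).1.dist_eq (hub _ hb)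
    have : 0 ≤ dist b z := dist_nonneg
    rw [h] at hlt
    linarith
  · exact le_of_tendsto (tendsto_const_nhds.dist hsz)
      (Eventually.of_forall fun n => (hcS _ (hs n)).2.2)

/-- There are points at any prescribed distance exactly between `x` and `y`, which
are joined to `x` in a straight way. -/
theorem IsLocallyConvexMap.exists_dist_eq [ProperSpace E] [StrictConvexSpace ℝ E]
    (hΨ : IsLocallyConvexMap Ψ) (x y : M) {T : ℝ} (hT : 0 ≤ T) (hTy : T ≤ dist x y) :
    ∃ z, dist x z = T ∧ dist x z + dist z y = dist x y ∧ dist (Ψ x) (Ψ z) = dist x z := by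
  rcases hT.eq_or_lt with rfl | hT
  · exact ⟨x, by simp⟩
  obtain ⟨r, hr, hiso, hstep⟩ := hΨ.exists_step x y
  set s := min r T with hs
  have hs0 : 0 < s := lt_min hr hT
  obtain ⟨w, hxw, hwy, hlim⟩ := hstep s hs0 (min_le_left _ _) ((min_le_right _ _).trans hTy)
  set v : E := s⁻¹ • (Ψ w - Ψ x) with hv
  have hwv : Ψ w - Ψ x = s • v := by rw [hv, smul_inv_smul₀ hs0.ne']
  have hv1 : ‖v‖ = 1 := by
    rw [hv, norm_smul, ← dist_eq_norm, dist_comm, hiso x w (by simpa using hr.le)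
      (hxw.trans_le (min_le_left _ _)), hxw, norm_inv, Real.norm_of_nonneg hs0.le,
      inv_mul_cancel₀ hs0.ne']
  let S : Set M := {z | StraightTo Ψ y v x z ∧ StraightLimit Ψ y v z ∧ dist x z ≤ T}
  have hwS : w ∈ S :=
    ⟨⟨hwy, by rw [hxw, hwv]⟩, hlim v hwv, hxw.trans_le (min_le_right _ _)⟩
  obtain ⟨⟨m, hm⟩, hmax⟩ := exists_maximal_of_chains_bounded
    (r := fun a b : S => StraightTo Ψ y v (a : M) b) (by
      intro c hc
      rcases c.eq_empty_or_nonempty with rfl | hne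
      · exact ⟨⟨w, hwS⟩, by simp⟩
      obtain ⟨z, h₁, h₂, h₃, h₄⟩ := hΨ.exists_upper_bound (c := Subtype.val '' c) (hne.image _)
        (T := T) (x := x) (y := y) (v := v) (by rintro _ ⟨a, -, rfl⟩; exact a.2) (by
          rintro _ ⟨a, ha, rfl⟩ _ ⟨b, hb, rfl⟩
          by_cases hab : a = b
          · rw [hab]; exact Or.inl (StraightTo.refl _ _ _ _)
          · exact hc ha hb hab)
      exact ⟨⟨z, h₁, h₂, h₃⟩, fun a ha => h₄ a ⟨a, ha, rfl⟩⟩)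
    (fun h₁ h₂ => h₁.trans h₂)
  obtain ⟨hxm, hml, hmT⟩ := hm
  have hmT' : dist x m = T := by
    by_contra hne
    have hlt : dist x m < T := lt_of_le_of_ne hmT hne
    obtain ⟨p, hpm, hpT, hp, hpl⟩ := hΨ.exists_straight_step hml (T := T - dist x m)
      (by linarith) (by linarith [hxm.1])
    have hpS : p ∈ S := ⟨hxm.trans hp, hpl, by linarith [hxm.dist_eq hp]⟩
    exact hpm ((hmax ⟨p, hpS⟩ hp).eq_of_symm hp)
  refine ⟨m, hmT', hxm.1, ?_⟩
  rw [dist_comm, dist_eq_norm, hxm.2, norm_smul, hv1, mul_one, Real.norm_of_nonneg dist_nonneg]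

theorem IsLocallyConvexMap.isometry [ProperSpace E] [StrictConvexSpace ℝ E]
    (hΨ : IsLocallyConvexMap Ψ) : Isometry Ψ := by
  refine Isometry.of_dist_eq fun x y => ?_
  obtain ⟨z, hxz, hz, hΨz⟩ := hΨ.exists_dist_eq x y dist_nonneg le_rfl
  obtain rfl : z = y := dist_eq_zero.1 (by linarith)
  exact hΨz

theorem IsLocallyConvexMap.convex_range [ProperSpace E] [StrictConvexSpace ℝ E]
    (hΨ : IsLocallyConvexMap Ψ) : Convex ℝ (range Ψ) := by
  rw [convex_iff_segment_subset]
  rintro _ ⟨x, rfl⟩ _ ⟨y, rfl⟩ e he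
  rw [segment_eq_image_lineMap] at he
  obtain ⟨t, ⟨ht₀, ht₁⟩, rfl⟩ := he
  have hd : 0 ≤ dist x y := dist_nonneg
  obtain ⟨z, hxz, hz, -⟩ := hΨ.exists_dist_eq x y (T := t * dist x y) (by positivity)
    (mul_le_of_le_one_left hd ht₁)
  refine ⟨z, eq_lineMap_of_dist_eq_mul_of_dist_eq_mul ?_ ?_⟩ <;>
    simp only [hΨ.isometry.dist_eq] <;> linarith

end Abstract

section CurveDist

variable {X E : Type*} [TopologicalSpace X]

section PseudoEMetric

variable [PseudoEMetricSpace E] {Ψ : X → E}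

theorem curveDist_le {γ : ℝ → X} {a b : ℝ} (hab : a ≤ b) (hγ : ContinuousOn γ (Icc a b)) :
    curveDist Ψ (γ a) (γ b) ≤ eVariationOn (Ψ ∘ γ) (Icc a b) := by
  have hmaps : MapsTo (fun t : ℝ => a + t * (b - a)) (Icc 0 1) (Icc a b) := by
    rintro t ⟨h₀, h₁⟩
    constructor <;> nlinarith
  refine (iInf₂_le (γ ∘ fun t : ℝ => a + t * (b - a)) ⟨?_, by simp, by simp⟩).trans ?_
  · refine eVariationOn.comp_le_of_monotoneOn (Ψ ∘ γ) _ (fun s _ t _ hst => ?_) hmaps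
    have : 0 ≤ b - a := by linarith
    gcongr
  · exact hγ.comp (by fun_prop) hmaps

theorem exists_curve_of_curveDist_lt {x y : X} {c : ℝ≥0∞} (h : curveDist Ψ x y < c) :
    ∃ γ : ℝ → X, ContinuousOn γ (Icc 0 1) ∧ γ 0 = x ∧ γ 1 = y ∧
      eVariationOn (Ψ ∘ γ) (Icc 0 1) < c := by
  simp only [curveDist, iInf_lt_iff] at h
  obtain ⟨γ, ⟨h₁, h₂, h₃⟩, h₄⟩ := h
  exact ⟨γ, h₁, h₂, h₃, h₄⟩

theorem curveDist_self (x : X) : curveDist Ψ x x = 0 := by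
  refine le_antisymm ?_ zero_le
  refine (curveDist_le (γ := fun _ => x) zero_le_one continuousOn_const).trans_eq ?_
  exact eVariationOn.constant_on (by rintro _ ⟨_, -, rfl⟩ _ ⟨_, -, rfl⟩; rfl)

theorem curveDist_comm_le (x y : X) : curveDist Ψ x y ≤ curveDist Ψ y x := by
  refine le_of_forall_gt fun c hc => ?_
  obtain ⟨γ, hγ, rfl, rfl, hlt⟩ := exists_curve_of_curveDist_lt hc
  have hmaps : MapsTo (fun t : ℝ => 1 - t) (Icc 0 1) (Icc 0 1) := by
    rintro t ⟨h₀, h₁⟩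
    constructor <;> linarith
  have h := curveDist_le (Ψ := Ψ) (γ := γ ∘ fun t : ℝ => 1 - t) zero_le_one
    (hγ.comp (by fun_prop) hmaps)
  simp only [Function.comp_apply, sub_zero, sub_self] at h
  refine (h.trans ?_).trans_lt hlt
  exact eVariationOn.comp_le_of_antitoneOn (Ψ ∘ γ) _ (fun s _ t _ hst => sub_le_sub_left hst 1)
    hmaps

theorem curveDist_comm (x y : X) : curveDist Ψ x y = curveDist Ψ y x :=
  le_antisymm (curveDist_comm_le x y) (curveDist_comm_le y x)

theorem curveDist_triangle (x y z : X) :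
    curveDist Ψ x z ≤ curveDist Ψ x y + curveDist Ψ y z := by
  refine ENNReal.le_of_forall_pos_le_add fun ε hε hfin => ?_
  have hε' : (ε / 2 : ℝ≥0∞) ≠ 0 := by simpa using hε.ne'
  obtain ⟨γ₁, hγ₁, rfl, h₁, hlt₁⟩ := exists_curve_of_curveDist_lt
    (ENNReal.lt_add_right (ENNReal.add_lt_top.1 hfin).1.ne hε')
  obtain ⟨γ₂, hγ₂, h₂, rfl, hlt₂⟩ := exists_curve_of_curveDist_lt
    (ENNReal.lt_add_right (ENNReal.add_lt_top.1 hfin).2.ne hε')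
  let γ : ℝ → X := fun t => if t ≤ 1 then γ₁ t else γ₂ (t - 1)
  have heq₁ : EqOn γ γ₁ (Icc 0 1) := fun t ht => if_pos ht.2
  have heq₂ : EqOn γ (γ₂ ∘ fun t => t - 1) (Icc 1 2) := by
    intro t ht
    rcases ht.1.eq_or_lt with rfl | h
    · simp [γ, h₁, h₂]
    · simp [γ, h.not_ge]
  have hmaps : MapsTo (fun t : ℝ => t - 1) (Icc 1 2) (Icc 0 1) := by
    rintro t ⟨h₀, h₁⟩
    constructor <;> linarith
  have hγ : ContinuousOn γ (Icc 0 2) := by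
    rw [← Icc_union_Icc_eq_Icc zero_le_one one_le_two]
    exact (hγ₁.congr heq₁).union_of_isClosed ((hγ₂.comp (by fun_prop) hmaps).congr heq₂)
      isClosed_Icc isClosed_Icc
  have hvar := eVariationOn.Icc_add_Icc (Ψ ∘ γ) (s := univ) zero_le_one one_le_two (mem_univ _)
  simp only [univ_inter] at hvar
  have hv₁ : eVariationOn (Ψ ∘ γ) (Icc 0 1) = eVariationOn (Ψ ∘ γ₁) (Icc 0 1) :=
    eVariationOn.congr fun t ht => congrArg Ψ (heq₁ ht)
  have hv₂ : eVariationOn (Ψ ∘ γ) (Icc 1 2) ≤ eVariationOn (Ψ ∘ γ₂) (Icc 0 1) := by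
    have hcongr : EqOn (Ψ ∘ γ) ((Ψ ∘ γ₂) ∘ fun t => t - 1) (Icc 1 2) :=
      fun t ht => congrArg Ψ (heq₂ ht)
    rw [eVariationOn.congr hcongr]
    exact eVariationOn.comp_le_of_monotoneOn (Ψ ∘ γ₂) _
      (fun s _ t _ hst => sub_le_sub_right hst 1) hmaps
  have h := curveDist_le (Ψ := Ψ) zero_le_two hγ
  have hγ0 : γ 0 = γ₁ 0 := heq₁ (by simp)
  have hγ2 : γ 2 = γ₂ 1 := by rw [heq₂ (by simp)]; norm_num
  rw [hγ0, hγ2, ← hvar, hv₁] at h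
  calc curveDist Ψ (γ₁ 0) (γ₂ 1)
      ≤ (curveDist Ψ (γ₁ 0) y + ε / 2) + (curveDist Ψ y (γ₂ 1) + ε / 2) :=
        h.trans (add_le_add hlt₁.le (hv₂.trans hlt₂.le))
    _ = _ := by rw [add_add_add_comm, ENNReal.add_halves]

theorem edist_le_curveDist (x y : X) : edist (Ψ x) (Ψ y) ≤ curveDist Ψ x y := by
  refine le_iInf₂ fun γ hγ => ?_
  obtain ⟨-, rfl, rfl⟩ := hγ
  exact eVariationOn.edist_le (Ψ ∘ γ) (by simp) (by simp)

end PseudoEMetric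

/-- The variation of an affine segment is at most the distance of its endpoints. -/
theorem eVariationOn_lineMap_le [NormedAddCommGroup E] [NormedSpace ℝ E] (a b : E) :
    eVariationOn (fun t : ℝ => AffineMap.lineMap a b t) (Icc 0 1) ≤ edist a b := by
  have hl : LipschitzOnWith (nndist a b) (fun t : ℝ => AffineMap.lineMap a b t) univ :=
    (lipschitzWith_lineMap a b).lipschitzOnWith
  have h := hl.comp_eVariationOn_le (g := (id : ℝ → ℝ)) (s := Icc 0 1) (mapsTo_univ _ _)
  have hid : eVariationOn (id : ℝ → ℝ) (Icc 0 1) ≤ 1 := by simp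
  rw [edist_nndist]
  calc _ ≤ _ := h
    _ ≤ (nndist a b : ℝ≥0∞) * 1 := by gcongr
    _ = _ := mul_one _

theorem exists_curveDist_chart [T2Space X] [NormedAddCommGroup E] [NormedSpace ℝ E]
    [ProperSpace E] {Ψ : X → E} {x : X} {U : Set X} {C : Set E}
    (hU : IsOpen U) (hxU : x ∈ U) (hinj : InjOn Ψ U) (hCc : IsClosed C) (hC : Convex ℝ C)
    (hUC : Ψ '' U ⊆ C) (hnhds : Ψ '' U ∈ nhdsWithin (Ψ x) C)
    (hopen : ∀ W : Set X, IsOpen W → W ⊆ U → ∃ O, IsOpen O ∧ Ψ '' W = O ∩ C) :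
    ∃ ε > 0, C ∩ Metric.closedBall (Ψ x) ε ⊆ Ψ '' U ∧
      (∀ p ∈ U, ∀ q ∈ U, Ψ p ∈ Metric.closedBall (Ψ x) ε → Ψ q ∈ Metric.closedBall (Ψ x) ε →
        curveDist Ψ p q = edist (Ψ p) (Ψ q)) ∧
      ∀ y, curveDist Ψ x y < ENNReal.ofReal ε → y ∈ U := by
  obtain ⟨ε', hε', hball⟩ := Metric.mem_nhdsWithin_iff.1 hnhds
  obtain ⟨ε, hε, hεε'⟩ := exists_between hε'
  have hsub : C ∩ Metric.closedBall (Ψ x) ε ⊆ Ψ '' U := fun e he =>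
    hball ⟨Metric.closedBall_subset_ball hεε' he.2, he.1⟩
  have : Nonempty X := ⟨x⟩
  set g := Function.invFunOn Ψ U with hg
  have hgl : ∀ p ∈ U, g (Ψ p) = p := fun p hp => hinj.leftInvOn_invFunOn hp
  have hgr : ∀ e ∈ Ψ '' U, Ψ (g e) = e := fun e he => Function.invFunOn_eq he
  have hgc : ContinuousOn g (Ψ '' U) := by
    rw [continuousOn_iff']
    intro W hW
    obtain ⟨O, hO, hOC⟩ := hopen (W ∩ U) (hW.inter hU) inter_subset_right
    refine ⟨O, hO, ?_⟩
    ext e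
    constructor
    · rintro ⟨heW, p, hp, rfl⟩
      rw [mem_preimage, hgl p hp] at heW
      exact ⟨(hOC.subset ⟨p, ⟨heW, hp⟩, rfl⟩).1, p, hp, rfl⟩
    · rintro ⟨heO, heU⟩
      obtain ⟨p, ⟨hpW, hpU⟩, rfl⟩ := hOC.superset ⟨heO, hUC heU⟩
      exact ⟨by rwa [mem_preimage, hgl p hpU], heU⟩
  refine ⟨ε, hε, hsub, fun p hp q hq hpε hqε => ?_, fun y hy => ?_⟩
  · refine le_antisymm ?_ (edist_le_curveDist p q)
    have hseg : ∀ t ∈ Icc (0 : ℝ) 1, AffineMap.lineMap (Ψ p) (Ψ q) t ∈ Ψ '' U := fun t ht =>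
      hsub ⟨hC.lineMap_mem (hUC ⟨p, hp, rfl⟩) (hUC ⟨q, hq, rfl⟩) ht,
        (convex_closedBall _ _).lineMap_mem hpε hqε ht⟩
    have h := curveDist_le (Ψ := Ψ) (γ := fun t : ℝ => g (AffineMap.lineMap (Ψ p) (Ψ q) t))
      zero_le_one (hgc.comp AffineMap.lineMap_continuous.continuousOn hseg)
    simp only [AffineMap.lineMap_apply_zero, AffineMap.lineMap_apply_one, hgl p hp, hgl q hq] at h
    refine h.trans (le_trans (le_of_eq ?_) (eVariationOn_lineMap_le _ _))
    exact eVariationOn.congr fun t ht => hgr _ (hseg t ht)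
  · obtain ⟨γ, hγ, h0, rfl, hvar⟩ := exists_curve_of_curveDist_lt hy
    have hγε : ∀ t ∈ Icc (0 : ℝ) 1, Ψ (γ t) ∈ Metric.closedBall (Ψ x) ε := by
      intro t ht
      have h := (eVariationOn.edist_le (Ψ ∘ γ) ht (left_mem_Icc.2 zero_le_one)).trans hvar.le
      rw [Function.comp_apply, Function.comp_apply, h0, edist_dist,
        ENNReal.ofReal_le_ofReal_iff hε.le] at h
      exact h
    have hK : IsClosed (g '' (C ∩ Metric.closedBall (Ψ x) ε)) :=
      (((isCompact_closedBall _ _).inter_left hCc).image_of_continuousOn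
        (hgc.mono hsub)).isClosed
    have hKU : ∀ t ∈ Icc (0 : ℝ) 1, γ t ∈ g '' (C ∩ Metric.closedBall (Ψ x) ε) ↔ γ t ∈ U := by
      refine fun t ht => ⟨?_, fun h => ⟨Ψ (γ t), ⟨hUC ⟨_, h, rfl⟩, hγε t ht⟩, hgl _ h⟩⟩
      rintro ⟨e, he, heq⟩
      rw [← heq]
      exact Function.invFunOn_mem (hsub he)
    have hpre : IsPreconnected (γ '' Icc 0 1) := isPreconnected_Icc.image _ hγ
    by_contra hy
    obtain ⟨_, ⟨t, ht, rfl⟩, htU, htK⟩ := hpre U _ hU hK.isOpen_compl (by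
        rintro _ ⟨t, ht, rfl⟩
        by_cases h : γ t ∈ U
        · exact Or.inl h
        · exact Or.inr fun hk => h ((hKU t ht).1 hk))
      ⟨γ 0, ⟨0, by simp, rfl⟩, h0 ▸ hxU⟩
      ⟨γ 1, ⟨1, by simp, rfl⟩, fun hk => hy ((hKU 1 (by simp)).1 hk)⟩
    exact htK ((hKU t ht).2 htU)

/-- The metric on `X` given by `curveDist`. -/
@[reducible]
noncomputable def curveMetricSpace [PseudoEMetricSpace E] (Ψ : X → E)
    (hfin : ∀ x y, curveDist Ψ x y ≠ ⊤) (hsep : ∀ x y, curveDist Ψ x y = 0 → x = y) :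
    MetricSpace X where
  dist x y := (curveDist Ψ x y).toReal
  dist_self x := by simp [curveDist_self]
  dist_comm x y := by rw [curveDist_comm]
  dist_triangle x y z := by
    rw [← ENNReal.toReal_add (hfin x y) (hfin y z)]
    exact ENNReal.toReal_mono (ENNReal.add_ne_top.2 ⟨hfin x y, hfin y z⟩)
      (curveDist_triangle x y z)
  eq_of_dist_eq_zero {x y} h := hsep x y
    (((ENNReal.toReal_eq_zero_iff _).1 h).resolve_right (hfin x y))

theorem continuous_curveDist [PseudoEMetricSpace E] {Ψ : X → E}
    (hfin : ∀ x y, curveDist Ψ x y ≠ ⊤)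
    (hlim : ∀ p, Tendsto (curveDist Ψ p) (nhds p) (nhds 0)) (x : X) :
    Continuous (curveDist Ψ x) := by
  rw [continuous_iff_continuousAt]
  intro p
  rw [ContinuousAt, ENNReal.tendsto_nhds (hfin x p)]
  intro ε hε
  filter_upwards [(hlim p).eventually (gt_mem_nhds hε)] with q hq
  refine ⟨tsub_le_iff_right.2 ?_, (curveDist_triangle x p q).trans (by gcongr)⟩
  refine (curveDist_triangle x q p).trans ?_
  rw [curveDist_comm q p]
  gcongr

/-- `X` with `curveDist` is a length space as soon as `curveDist` is continuous. -/
theorem exists_between_curveDist [PseudoEMetricSpace E] {Ψ : X → E}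
    (hfin : ∀ x y, curveDist Ψ x y ≠ ⊤) (hcont : ∀ x, Continuous (curveDist Ψ x))
    (x y : X) (s : ℝ) (hs : 0 ≤ s) (hsy : s ≤ (curveDist Ψ x y).toReal) (ε : ℝ) (hε : 0 < ε) :
    ∃ z, (curveDist Ψ x z).toReal = s ∧
      (curveDist Ψ z y).toReal < (curveDist Ψ x y).toReal - s + ε := by
  obtain ⟨γ, hγ, rfl, rfl, hlt⟩ := exists_curve_of_curveDist_lt
    (ENNReal.lt_add_right (hfin x y) (ENNReal.ofReal_pos.2 hε).ne')
  set x := γ 0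
  set y := γ 1
  obtain ⟨t, ht, hts⟩ := intermediate_value_Icc zero_le_one ((hcont x).comp_continuousOn hγ)
    (show ENNReal.ofReal s ∈ Icc (curveDist Ψ x x) (curveDist Ψ x y) from
      ⟨by simp [curveDist_self], ENNReal.ofReal_le_of_le_toReal hsy⟩)
  rw [Function.comp_apply] at hts
  have hvar := eVariationOn.Icc_add_Icc (Ψ ∘ γ) (s := univ) ht.1 ht.2 (mem_univ _)
  simp only [univ_inter] at hvar
  have h₁ := curveDist_le (Ψ := Ψ) ht.1 (hγ.mono (Icc_subset_Icc_right ht.2))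
  have h₂ := curveDist_le (Ψ := Ψ) ht.2 (hγ.mono (Icc_subset_Icc_left ht.1))
  have h₃ : curveDist Ψ x (γ t) + curveDist Ψ (γ t) y < curveDist Ψ x y + ENNReal.ofReal ε :=
    ((add_le_add h₁ h₂).trans_eq hvar).trans_lt hlt
  have h₄ := (ENNReal.toReal_lt_toReal (ENNReal.add_ne_top.2 ⟨hfin _ _, hfin _ _⟩)
    (ENNReal.add_ne_top.2 ⟨hfin _ _, ENNReal.ofReal_ne_top⟩)).2 h₃
  rw [ENNReal.toReal_add (hfin _ _) (hfin _ _), ENNReal.toReal_add (hfin _ _) (by simp),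
    ENNReal.toReal_ofReal hε.le, hts, ENNReal.toReal_ofReal hs] at h₄
  exact ⟨γ t, by rw [hts, ENNReal.toReal_ofReal hs], by linarith⟩

end CurveDist

/-- Corollary of the modified Lokal-global-Prinzip: if `Ψ : X → ℝⁿ`
is locally injective onto cone neighbourhoods (local convexity data with injective
local charts), the pull-back distance `d` (infimum of total variations of `Ψ ∘ γ`)
is finite, separates points, and makes `X` complete, then `Ψ(X)` is convex and `Ψ`
is injective. -/
theorem stmt_12 {X : Type*} [TopologicalSpace X] [ConnectedSpace X] [T2Space X]
    (n : ℕ) (hn : 1 ≤ n) (Ψ : X → EuclideanSpace ℝ (Fin n)) (hΨ : Continuous Ψ)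
    (hloc : ∀ x : X, ∀ V ∈ nhds x,
      ∃ (U : Set X) (C : Set (EuclideanSpace ℝ (Fin n))),
        IsOpen U ∧ x ∈ U ∧ U ⊆ V ∧ Set.InjOn Ψ U ∧ IsClosed C ∧ Convex ℝ C ∧
        (∀ p ∈ C, ∀ s : ℝ, 0 ≤ s → Ψ x + s • (p - Ψ x) ∈ C) ∧
        Ψ '' U ⊆ C ∧ Ψ '' U ∈ nhdsWithin (Ψ x) C ∧
        (∀ W : Set X, IsOpen W → W ⊆ U → ∃ O, IsOpen O ∧ Ψ '' W = O ∩ C))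
    (d : X → X → ℝ)
    (hd : ∀ x y : X, ENNReal.ofReal (d x y) = curveDist Ψ x y)
    (hd0 : ∀ x y : X, d x y = 0 → x = y)
    (hcomplete : ∀ u : ℕ → X,
      (∀ ε : ℝ, 0 < ε → ∃ N : ℕ, ∀ m ≥ N, ∀ l ≥ N, d (u m) (u l) < ε) →
      ∃ x : X, Tendsto (fun i => d (u i) x) atTop (nhds 0)) :
    Convex ℝ (Set.range Ψ) ∧ Function.Injective Ψ := by
  have hchart : ∀ x : X, ∃ (U : Set X) (C : Set (EuclideanSpace ℝ (Fin n))), ∃ ε > 0,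
      IsOpen U ∧ x ∈ U ∧ InjOn Ψ U ∧ IsClosed C ∧ Convex ℝ C ∧ Ψ '' U ⊆ C ∧
      C ∩ Metric.closedBall (Ψ x) ε ⊆ Ψ '' U ∧
      (∀ p ∈ U, ∀ q ∈ U, Ψ p ∈ Metric.closedBall (Ψ x) ε → Ψ q ∈ Metric.closedBall (Ψ x) ε →
        curveDist Ψ p q = edist (Ψ p) (Ψ q)) ∧
      ∀ y, curveDist Ψ x y < ENNReal.ofReal ε → y ∈ U := by
    intro x
    obtain ⟨U, C, hU, hxU, -, hinj, hCc, hC, -, hUC, hnhds, hopen⟩ := hloc x univ univ_mem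
    obtain ⟨ε, hε, h₁, h₂, h₃⟩ := exists_curveDist_chart hU hxU hinj hCc hC hUC hnhds hopen
    exact ⟨U, C, ε, hε, hU, hxU, hinj, hCc, hC, hUC, h₁, h₂, h₃⟩
  have hfin : ∀ x y, curveDist Ψ x y ≠ ⊤ := fun x y => by
    rw [← hd]
    exact ENNReal.ofReal_ne_top
  have hsep : ∀ x y, curveDist Ψ x y = 0 → x = y := by
    intro x y hxy
    obtain ⟨U, C, ε, hε, -, hxU, hinj, -, -, -, -, -, hmem⟩ := hchart x
    refine hinj hxU (hmem y (by simpa [hxy] using hε)) (edist_eq_zero.1 ?_)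
    exact le_antisymm ((edist_le_curveDist x y).trans_eq hxy) zero_le
  have hlim : ∀ p, Tendsto (curveDist Ψ p) (nhds p) (nhds 0) := by
    intro p
    obtain ⟨U, C, ε, hε, hU, hpU, -, -, -, -, -, heq, -⟩ := hchart p
    have h : Tendsto (fun q => edist (Ψ p) (Ψ q)) (nhds p) (nhds 0) := by
      have : Continuous fun q => edist (Ψ p) (Ψ q) := by fun_prop
      simpa using this.tendsto p
    refine h.congr' ?_
    filter_upwards [hU.mem_nhds hpU,
      hΨ.continuousAt.preimage_mem_nhds (Metric.closedBall_mem_nhds _ hε)] with q hqU hq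
    exact (heq p hpU q hqU (Metric.mem_closedBall_self hε.le) hq).symm
  have hmap : @IsLocallyConvexMap X (EuclideanSpace ℝ (Fin n)) (curveMetricSpace Ψ hfin hsep)
      _ _ Ψ := by
    refine @IsLocallyConvexMap.mk X _ (curveMetricSpace Ψ hfin hsep) _ _ Ψ
      (exists_between_curveDist hfin (continuous_curveDist hfin hlim)) (fun x => ?_)
      (fun u hu => ?_)
    · obtain ⟨U, C, ε, hε, hU, hxU, hinj, hCc, hC, hUC, hsub, heq, hmem⟩ := hchart x
      have hball : ∀ p, (curveDist Ψ x p).toReal ≤ ε / 2 →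
          p ∈ U ∧ Ψ p ∈ Metric.closedBall (Ψ x) ε := by
        intro p hp
        have hle := (ENNReal.le_ofReal_iff_toReal_le (hfin x p) (by positivity)).2 hp
        have hlt : curveDist Ψ x p < ENNReal.ofReal ε :=
          hle.trans_lt ((ENNReal.ofReal_lt_ofReal_iff hε).2 (half_lt_self hε))
        refine ⟨hmem p hlt, ?_⟩
        have h := (edist_le_curveDist x p).trans hlt.le
        rwa [edist_dist, ENNReal.ofReal_le_ofReal_iff hε.le, dist_comm] at h
      refine ⟨ε / 2, half_pos hε, C, hCc, hC, fun p hp => hUC ⟨p, (hball p hp).1, rfl⟩,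
        fun p q hp hq => ?_, fun e he hex => ?_⟩
      · obtain ⟨hpU, hpε⟩ := hball p hp
        obtain ⟨hqU, hqε⟩ := hball q hq
        change _ = (curveDist Ψ p q).toReal
        rw [heq p hpU q hqU hpε hqε, dist_edist]
      · have heε : e ∈ Metric.closedBall (Ψ x) ε := by
          rw [Metric.mem_closedBall, dist_comm]
          linarith
        obtain ⟨p, hpU, rfl⟩ := hsub ⟨he, heε⟩
        refine ⟨p, ?_, rfl⟩
        change (curveDist Ψ x p).toReal ≤ _
        rwa [heq x hxU p hpU (Metric.mem_closedBall_self hε.le) heε, ← dist_edist]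
    · have hdmax : ∀ x y, (curveDist Ψ x y).toReal = max (d x y) 0 := fun x y => by
        rw [← hd, ENNReal.toReal_ofReal']
      obtain ⟨x, hx⟩ := hcomplete u fun ε hε => by
        obtain ⟨N, hN⟩ := hu ε hε
        refine ⟨N, fun m hm l hl => (le_max_left _ 0).trans_lt ?_⟩
        rw [← hdmax]
        exact hN m hm l hl
      refine ⟨x, ?_⟩
      have h : Tendsto (fun i => max (d (u i) x) 0) atTop (nhds 0) := by
        simpa using hx.max (tendsto_const_nhds (x := (0 : ℝ)))
      exact h.congr fun i => (hdmax (u i) x).symm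
  exact ⟨@IsLocallyConvexMap.convex_range X _ (curveMetricSpace Ψ hfin hsep) _ _ Ψ _ _ hmap,
    @Isometry.injective _ _ (curveMetricSpace Ψ hfin hsep).toEMetricSpace _ Ψ
      (@IsLocallyConvexMap.isometry X _ (curveMetricSpace Ψ hfin hsep) _ _ Ψ _ _ hmap)⟩
end

section
/- Let q₀, q₁, q₂ ∈ ℝ and let q(x,y) = q₀xy + q₁(x+y) + q₂. Let I, J ⊆ ℝ be nonempty open intervals on which q(x,y) ≠ 0 for all (x,y) ∈ I×J, and suppose there exist functions F : I → ℝ and G : J → ℝ such that q(x,y)⁴ = F(x)·G(y) for all (x,y) ∈ I×J. Then q₁² = q₀q₂; that is, the quadratic q(z) = q₀z² + 2q₁z + q₂ has vanishing discriminant (the parabolic case). -/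
/-- A continuous real function without zeros on a preconnected set has constant sign there. -/
theorem IsPreconnected.mul_pos_of_forall_ne_zero {X : Type*} [TopologicalSpace X] {s : Set X}
    (hs : IsPreconnected s) {f : X → ℝ} (hf : ContinuousOn f s) (h0 : ∀ x ∈ s, f x ≠ 0)
    {a b : X} (ha : a ∈ s) (hb : b ∈ s) : 0 < f a * f b := by
  by_contra! h
  obtain ⟨h1, h2⟩ | ⟨h1, h2⟩ := mul_nonpos_iff.mp h
  · obtain ⟨c, hc, hc0⟩ := hs.intermediate_value hb ha hf ⟨h2, h1⟩
    exact h0 c hc hc0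
  · obtain ⟨c, hc, hc0⟩ := hs.intermediate_value ha hb hf ⟨h1, h2⟩
    exact h0 c hc hc0

/-- A nonempty open set of reals has two distinct points. -/
theorem IsOpen.nontrivial_of_nonempty_real {s : Set ℝ} (hs : IsOpen s) (hne : s.Nonempty) :
    s.Nontrivial := by
  obtain ⟨x, hx⟩ := hne
  exact (infinite_of_mem_nhds x (hs.mem_nhds hx)).nontrivial

/-- Real numbers of the same strict sign with equal nonzero powers are equal. -/
theorem eq_of_pow_eq_pow_of_mul_pos {a b : ℝ} {n : ℕ} (hn : n ≠ 0) (h : a ^ n = b ^ n)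
    (hab : 0 < a * b) : a = b := by
  rcases (pow_eq_pow_iff_of_ne_zero hn).mp h with h | ⟨h, -⟩
  · exact h
  · rw [h] at hab
    nlinarith [sq_nonneg b]

/-- If the fourth power of the polarization `q(x,y) = q₀xy + q₁(x+y) + q₂`
splits as a product `F(x)·G(y)` on a product of nonempty open intervals where `q(x,y) ≠ 0`,
then the quadratic `q(z) = q₀z² + 2q₁z + q₂` has vanishing discriminant: `q₁² = q₀q₂`. -/
theorem stmt_17 (q0 q1 q2 : ℝ)
    (I J : Set ℝ) (hIo : IsOpen I) (hIc : I.OrdConnected) (hIne : I.Nonempty)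
    (hJo : IsOpen J) (hJc : J.OrdConnected) (hJne : J.Nonempty)
    (hq : ∀ x ∈ I, ∀ y ∈ J, q0 * x * y + q1 * (x + y) + q2 ≠ 0)
    (F G : ℝ → ℝ)
    (hFG : ∀ x ∈ I, ∀ y ∈ J, (q0 * x * y + q1 * (x + y) + q2) ^ 4 = F x * G y) :
    q1 ^ 2 = q0 * q2 := by
  obtain ⟨x, hx, x', hx', hxx⟩ := hIo.nontrivial_of_nonempty_real hIne
  obtain ⟨y, hy, y', hy', hyy⟩ := hJo.nontrivial_of_nonempty_real hJne
  have sign : ∀ v ∈ J, 0 < (q0 * x * v + q1 * (x + v) + q2) *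
      (q0 * x' * v + q1 * (x' + v) + q2) := fun v hv =>
    hIc.isPreconnected.mul_pos_of_forall_ne_zero
      (f := fun u => q0 * u * v + q1 * (u + v) + q2) (by fun_prop)
      (fun u hu => hq u hu v hv) hx hx'
  have hpow : ((q0 * x * y + q1 * (x + y) + q2) * (q0 * x' * y' + q1 * (x' + y') + q2)) ^ 4 =
      ((q0 * x * y' + q1 * (x + y') + q2) * (q0 * x' * y + q1 * (x' + y) + q2)) ^ 4 := by
    rw [mul_pow, mul_pow, hFG x hx y hy, hFG x' hx' y' hy', hFG x hx y' hy', hFG x' hx' y hy]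
    ring
  have hpos := mul_pos (sign y hy) (sign y' hy')
  have hcross : (q0 * x * y + q1 * (x + y) + q2) * (q0 * x' * y' + q1 * (x' + y') + q2) =
      (q0 * x * y' + q1 * (x + y') + q2) * (q0 * x' * y + q1 * (x' + y) + q2) := by
    refine eq_of_pow_eq_pow_of_mul_pos four_ne_zero hpow (hpos.trans_eq ?_)
    ring
  have hfactor : (x - x') * (y - y') * (q1 ^ 2 - q0 * q2) = 0 := by
    linear_combination -hcross
  exact sub_eq_zero.mp ((mul_eq_zero.mp hfactor).resolve_left
    (mul_ne_zero (sub_ne_zero.mpr hxx) (sub_ne_zero.mpr hyy)))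
end
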